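/- arXiv:2210.10287 — 4 statements merged into one kernel-verified Lean document; each statement's English description precedes it below -/
import Mathlib

section
/- Let K ⊂ M₂(ℂ) ≅ ℂ⁴ be a compact set each of whose elements is a rank-one idempotent matrix. Then every element of the polynomially convex hull K̂ of K is also a rank-one idempotent matrix; that is, K̂ ⊂ ID₁(ℂ₂). -/
open MeasureTheory

noncomputable instance (n : ℕ) : MeasurableSpace (EuclideanSpace ℂ (Fin n)) := borel _
instance (n : ℕ) : BorelSpace (EuclideanSpace ℂ (Fin n)) := ⟨rfl⟩

/-- The polynomially convex hull of a bounded set `K ⊂ ℂⁿ`: all points at which every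
polynomial in `n` complex variables is bounded by its supremum over `K`. -/
def polyHull {n : ℕ} (K : Set (EuclideanSpace ℂ (Fin n))) : Set (EuclideanSpace ℂ (Fin n)) :=
  {z | ∀ p : MvPolynomial (Fin n) ℂ,
    ‖MvPolynomial.eval (fun i => z i) p‖ ≤
      sSup ((fun w => ‖MvPolynomial.eval (fun i => w i) p‖) '' K)}

/-- The `2×2` complex matrix corresponding to a point of `ℂ⁴`
(`(z₁,z₂,z₃,z₄) ↦ [[z₁,z₂],[z₃,z₄]]`). -/
noncomputable def toMat (z : EuclideanSpace ℂ (Fin 4)) : Matrix (Fin 2) (Fin 2) ℂ :=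
  !![z 0, z 1; z 2, z 3]

/-- The point `z ∈ ℂ⁴` corresponds to a rank-one idempotent `2×2` matrix. -/
def IsRankOneIdem (z : EuclideanSpace ℂ (Fin 4)) : Prop :=
  toMat z * toMat z = toMat z ∧ (toMat z).rank = 1

/-- The trace of an idempotent matrix over a field is its rank. -/
theorem Matrix.trace_eq_rank_of_isIdempotentElem {F n : Type*} [Field F] [Fintype n]
    [DecidableEq n] {A : Matrix n n F} (hA : IsIdempotentElem A) : A.trace = A.rank := by
  have h : IsIdempotentElem (Matrix.toLin' A) := by
    rw [IsIdempotentElem, Module.End.mul_eq_comp, ← Matrix.toLin'_mul, hA.eq]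
  rw [← Matrix.trace_toLin'_eq, (LinearMap.IsIdempotentElem.isProj_range _ h).trace]
  rfl

/-- A point of `ℂ⁴` is a rank-one idempotent iff its matrix is idempotent of trace one. -/
theorem isRankOneIdem_iff (z : EuclideanSpace ℂ (Fin 4)) :
    IsRankOneIdem z ↔ IsIdempotentElem (toMat z) ∧ (toMat z).trace = 1 := by
  refine and_congr_right fun h => ?_
  rw [Matrix.trace_eq_rank_of_isIdempotentElem h, Nat.cast_eq_one]

/-- Rank-one idempotents are cut out by polynomial equations in the entries. -/
theorem isRankOneIdem_iff_entries (z : EuclideanSpace ℂ (Fin 4)) :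
    IsRankOneIdem z ↔ (z 0 * z 0 + z 1 * z 2 - z 0 = 0 ∧ z 0 * z 1 + z 1 * z 3 - z 1 = 0 ∧
      z 2 * z 0 + z 3 * z 2 - z 2 = 0 ∧ z 2 * z 1 + z 3 * z 3 - z 3 = 0) ∧
      z 0 + z 3 - 1 = 0 := by
  rw [isRankOneIdem_iff]
  simp [toMat, IsIdempotentElem, Matrix.trace_fin_two,
    sub_eq_zero, and_assoc]

/-- A polynomial vanishing on `K` vanishes on the polynomially convex hull of `K`. -/
theorem eval_eq_zero_of_mem_polyHull {n : ℕ} {K : Set (EuclideanSpace ℂ (Fin n))}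
    {z : EuclideanSpace ℂ (Fin n)} (hz : z ∈ polyHull K) (p : MvPolynomial (Fin n) ℂ)
    (hp : ∀ w ∈ K, MvPolynomial.eval (fun i => w i) p = 0) :
    MvPolynomial.eval (fun i => z i) p = 0 := by
  refine norm_le_zero_iff.mp ((hz p).trans (Real.sSup_nonpos ?_))
  rintro _ ⟨w, hw, rfl⟩
  simp [hp w hw]

/-! **Statement 13.**
If `K ⊂ M₂(ℂ) ≅ ℂ⁴` is a compact set each of whose elements is a rank-one idempotent
matrix, then every element of the polynomially convex hull `K̂` of `K` is also a
rank-one idempotent matrix. -/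

theorem polyHull_of_rank_one_idempotents_consists_of_rank_one_idempotents
    (K : Set (EuclideanSpace ℂ (Fin 4))) (hK : IsCompact K)
    (hidem : ∀ z ∈ K, IsRankOneIdem z) :
    ∀ z ∈ polyHull K, IsRankOneIdem z := by
  intro z hz
  simp only [isRankOneIdem_iff_entries] at hidem ⊢
  refine ⟨⟨?_, ?_, ?_, ?_⟩, ?_⟩
  · simpa using eval_eq_zero_of_mem_polyHull hz (.X 0 * .X 0 + .X 1 * .X 2 - .X 0)
      fun w hw => by simpa using (hidem w hw).1.1
  · simpa using eval_eq_zero_of_mem_polyHull hz (.X 0 * .X 1 + .X 1 * .X 3 - .X 1)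
      fun w hw => by simpa using (hidem w hw).1.2.1
  · simpa using eval_eq_zero_of_mem_polyHull hz (.X 2 * .X 0 + .X 3 * .X 2 - .X 2)
      fun w hw => by simpa using (hidem w hw).1.2.2.1
  · simpa using eval_eq_zero_of_mem_polyHull hz (.X 2 * .X 1 + .X 3 * .X 3 - .X 3)
      fun w hw => by simpa using (hidem w hw).1.2.2.2
  · simpa using eval_eq_zero_of_mem_polyHull hz (.X 0 + .X 3 - 1)
      fun w hw => by simpa using (hidem w hw).2
end

section
/- Let I=[a,b] be a finite interval and let F = (f₁,…,fₙ) : I → ℂⁿ be a map each of whose coordinate functions has bounded variation on I. Then the image F(I) is contained in a compact connected subset of ℂⁿ of finite one-dimensional Hausdorff measure. -/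
open MeasureTheory

/-- The distances of a Euclidean-valued map on a linear order whose coordinates all have bounded
variation are controlled by a monotone real function. -/
theorem exists_monotone_dist_le_of_boundedVariationOn {α : Type*} [LinearOrder α] [Nonempty α]
    {n : ℕ} (F : α → EuclideanSpace ℂ (Fin n))
    (hF : ∀ i, BoundedVariationOn (fun x => F x i) Set.univ) :
    ∃ v : α → ℝ, Monotone v ∧ ∀ s t, dist (F s) (F t) ≤ dist (v s) (v t) := by
  obtain ⟨c⟩ := (inferInstance : Nonempty α)
  have key : ∀ i s t, s ≤ t → dist (F s i) (F t i) ≤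
      variationOnFromTo (fun x => F x i) Set.univ c t -
        variationOnFromTo (fun x => F x i) Set.univ c s := by
    intro i s t hst
    have hadd := variationOnFromTo.add (hF i).locallyBoundedVariationOn
      (Set.mem_univ c) (Set.mem_univ s) (Set.mem_univ t)
    have heq := variationOnFromTo.eq_of_le (fun x => F x i) Set.univ hst
    have hle : dist (F s i) (F t i) ≤ _ :=
      ((hF i).mono (Set.inter_subset_left (t := Set.Icc s t))).dist_le
        ⟨Set.mem_univ s, le_refl s, hst⟩ ⟨Set.mem_univ t, hst, le_refl t⟩
    linarith
  have hle : ∀ s t, s ≤ t → dist (F s) (F t) ≤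
      ∑ i, variationOnFromTo (fun x => F x i) Set.univ c t -
        ∑ i, variationOnFromTo (fun x => F x i) Set.univ c s := by
    intro s t hst
    rw [← Finset.sum_sub_distrib, EuclideanSpace.dist_eq]
    calc √(∑ i, dist (F s i) (F t i) ^ 2) ≤ ∑ i, dist (F s i) (F t i) :=
          Real.sqrt_le_iff.2 ⟨Finset.sum_nonneg fun i _ => dist_nonneg,
            Finset.sum_sq_le_sq_sum_of_nonneg fun i _ => dist_nonneg⟩
      _ ≤ _ := Finset.sum_le_sum fun i _ => key i s t hst
  have hmono : Monotone fun t => ∑ i, variationOnFromTo (fun x => F x i) Set.univ c t :=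
    fun s t hst => sub_nonneg.1 (dist_nonneg.trans (hle s t hst))
  refine ⟨_, hmono, fun s t => ?_⟩
  rcases le_total s t with hst | hst
  · rw [dist_comm (∑ i, _), Real.dist_eq]
    exact (hle s t hst).trans (le_abs_self _)
  · rw [dist_comm (F s), Real.dist_eq]
    exact (hle t s hst).trans (le_abs_self _)

/-! **Statement 14.**
Let `I = [a,b]` be a finite interval and `F = (f₁,…,fₙ) : I → ℂⁿ` a map each of whose
coordinate functions has bounded variation on `I`.  Then the image `F(I)` is contained
in a compact connected subset of `ℂⁿ` of finite one-dimensional Hausdorff measure. -/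

theorem range_of_BV_map_contained_in_continuum_of_finite_length
    {a b : ℝ} (hab : a < b) {n : ℕ}
    (F : Set.Icc a b → EuclideanSpace ℂ (Fin n))
    (hbv : ∀ i : Fin n, BoundedVariationOn (fun x => F x i) Set.univ) :
    ∃ E : Set (EuclideanSpace ℂ (Fin n)),
      IsCompact E ∧ IsConnected E ∧ Set.range F ⊆ E ∧ μH[1] E < ⊤ := by
  have : Nonempty (Set.Icc a b) := ⟨⟨a, Set.left_mem_Icc.2 hab.le⟩⟩
  obtain ⟨v, hv, hdist⟩ := exists_monotone_dist_le_of_boundedVariationOn F hbv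
  have hfac : ∀ x, F (Function.invFun v (v x)) = F x := fun x => by
    refine dist_le_zero.1 ((hdist _ _).trans ?_)
    rw [Function.invFun_eq (f := v) ⟨x, rfl⟩, dist_self]
  have hlip : LipschitzOnWith 1 (F ∘ Function.invFun v) (Set.range v) := by
    refine LipschitzOnWith.of_dist_le_mul ?_
    rintro _ ⟨x, rfl⟩ _ ⟨y, rfl⟩
    simpa [hfac] using hdist x y
  obtain ⟨G, hG, hGeq⟩ := hlip.extend_finite_dimension
  have hle : v ⟨a, Set.left_mem_Icc.2 hab.le⟩ ≤ v ⟨b, Set.right_mem_Icc.2 hab.le⟩ := hv hab.le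
  refine ⟨G '' Set.Icc (v ⟨a, Set.left_mem_Icc.2 hab.le⟩) (v ⟨b, Set.right_mem_Icc.2 hab.le⟩),
    isCompact_Icc.image hG.continuous,
    (isConnected_Icc hle).image _ hG.continuous.continuousOn, ?_, ?_⟩
  · rintro _ ⟨x, rfl⟩
    refine ⟨v x, ⟨hv x.2.1, hv x.2.2⟩, ?_⟩
    rw [← hGeq ⟨x, rfl⟩, Function.comp_apply, hfac]
  · refine (hG.hausdorffMeasure_image_le zero_le_one _).trans_lt ?_
    rw [hausdorffMeasure_real, Real.volume_Icc, ENNReal.rpow_one]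
    exact ENNReal.mul_lt_top ENNReal.coe_lt_top ENNReal.ofReal_lt_top
end

section
/- Let I=[a,b] be a finite interval. The maximal ideal space 𝔐(BV(I)) of the Banach algebra BV(I) of complex-valued functions of bounded variation on I (with norm ‖f‖ = sup_I |f| + V_I(f)) has covering dimension 0, and its Čech cohomology groups Hⁱ(𝔐(BV(I)),ℤ) vanish for all i ≥ 1. -/
/-! Čech cohomology with integer coefficients, defined via unindexed open covers. -/

namespace CechPaper

variable (X : Type*) [TopologicalSpace X]

/-- An (unindexed) open cover of `X`: a collection of open sets covering `X`. -/
def IsCover (𝒰 : Set (Set X)) : Prop :=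
  (∀ U ∈ 𝒰, IsOpen U) ∧ ∀ x : X, ∃ U ∈ 𝒰, x ∈ U

/-- Čech `n`-cochains (with respect to covers by subsets of `X`) with integer
coefficients: an integer for each `(n+1)`-tuple of sets. -/
abbrev Cochain (n : ℕ) := (Fin (n + 1) → Set X) → ℤ

/-- The Čech coboundary operator. -/
def coboundary {n : ℕ} (c : Cochain X n) : Cochain X (n + 1) := fun σ =>
  ∑ i : Fin (n + 2), (-1 : ℤ) ^ (i : ℕ) * c (σ ∘ i.succAbove)

/-- A tuple of sets is relevant for the cover `𝒰` if all its members belong to `𝒰`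
and it is a simplex of the nerve of `𝒰`, i.e. the total intersection is nonempty. -/
def Relevant (𝒰 : Set (Set X)) {m : ℕ} (σ : Fin m → Set X) : Prop :=
  (∀ j, σ j ∈ 𝒰) ∧ (⋂ j, σ j).Nonempty

/-- `c` is a cocycle on the nerve of the cover `𝒰`. -/
def IsCocycle (𝒰 : Set (Set X)) {n : ℕ} (c : Cochain X n) : Prop :=
  ∀ σ : Fin (n + 2) → Set X, Relevant X 𝒰 σ → coboundary X c σ = 0

/-- A representative of a degree `n+1` Čech cohomology class: an open cover
together with an `(n+1)`-cocycle on its nerve. -/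
structure Elem (n : ℕ) where
  cov : Set (Set X)
  isCover : IsCover X cov
  coc : Cochain X (n + 1)
  isCocycle : IsCocycle X cov coc

/-- `𝒲` refines `𝒰` with refinement map `r`. -/
def RefinesWith (𝒲 𝒰 : Set (Set X)) (r : Set X → Set X) : Prop :=
  ∀ W ∈ 𝒲, r W ∈ 𝒰 ∧ W ⊆ r W

/-- Two cover/cocycle pairs define the same Čech cohomology class iff on some common
refinement the difference of (the restrictions of) the cocycles is a coboundary. -/
def Rel {n : ℕ} (e₁ e₂ : Elem X n) : Prop :=
  ∃ (𝒲 : Set (Set X)) (r₁ r₂ : Set X → Set X) (b : Cochain X n),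
    IsCover X 𝒲 ∧ RefinesWith X 𝒲 e₁.cov r₁ ∧ RefinesWith X 𝒲 e₂.cov r₂ ∧
    ∀ σ : Fin (n + 2) → Set X, Relevant X 𝒲 σ →
      e₁.coc (r₁ ∘ σ) - e₂.coc (r₂ ∘ σ) = coboundary X b σ

/-- The Čech cohomology group `H^{n+1}(X, ℤ)` (as a set: the colimit over all open
covers, directed by refinement, of the cohomology of their nerves). -/
def CechHSucc (n : ℕ) := Quot (Rel X (n := n))

/-- The second Čech cohomology `H²(X, ℤ)` of `X` with integer coefficients. -/
abbrev CechH2 := CechHSucc X 1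

/-- The covering dimension of `X` is at most `n`: every open cover admits an open
refinement such that no `n+2` distinct members of it have a common point. -/
def CovDimLE (n : ℕ) : Prop :=
  ∀ 𝒰 : Set (Set X), IsCover X 𝒰 →
    ∃ 𝒱 : Set (Set X), IsCover X 𝒱 ∧ (∀ V ∈ 𝒱, ∃ U ∈ 𝒰, V ⊆ U) ∧
      ∀ T : Finset (Set X), ↑T ⊆ 𝒱 → (⋂₀ (T : Set (Set X))).Nonempty → T.card ≤ n + 1

end CechPaper

open CechPaper WeakDual

namespace CechPaper

theorem coboundary_const {X : Type*} {n : ℕ} (c : Cochain X n) (W : Set X) :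
    coboundary X c (fun _ ↦ W) = (if Even n then 0 else 1) * c fun _ ↦ W := by
  simp only [coboundary, Function.comp_def, ← Finset.sum_mul, Fin.sum_neg_one_pow]
  simp [Nat.even_add]

theorem IsCocycle.apply_const_eq_zero {X : Type*} {𝒰 : Set (Set X)} {n : ℕ} {c : Cochain X n}
    (hc : IsCocycle X 𝒰 c) (hn : Odd n) {U : Set X} (hU : U ∈ 𝒰) (hne : U.Nonempty) :
    c (fun _ ↦ U) = 0 := by
  have := hc (fun _ ↦ U) ⟨fun _ ↦ hU, by simpa [Set.iInter_const] using hne⟩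
  simpa [coboundary_const, Nat.not_even_iff_odd.2 hn] using this

section Profinite

variable {X : Type*} [TopologicalSpace X] [CompactSpace X] [T2Space X] [TotallyDisconnectedSpace X]

theorem IsCover.exists_pairwiseDisjoint_refinement {𝒰 : Set (Set X)} (h𝒰 : IsCover X 𝒰) :
    ∃ 𝒱 : Set (Set X), IsCover X 𝒱 ∧ (∀ V ∈ 𝒱, ∃ U ∈ 𝒰, V ⊆ U) ∧ 𝒱.PairwiseDisjoint id := by
  have hU : TopologicalSpace.IsOpenCover
      (fun U : 𝒰 ↦ (⟨U, h𝒰.1 U U.2⟩ : TopologicalSpace.Opens X)) :=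
    .of_sets (fun U : 𝒰 ↦ h𝒰.1 U U.2) <| Set.eq_univ_of_forall fun x ↦
      let ⟨U, hU, hx⟩ := h𝒰.2 x
      Set.mem_iUnion.2 ⟨⟨U, hU⟩, hx⟩
  obtain ⟨n, W, hW, hcov, hdisj⟩ := hU.exists_finite_nonempty_disjoint_clopen_cover
  refine ⟨Set.range fun j ↦ (W j : Set X), ⟨?_, fun x ↦ ?_⟩, ?_, ?_⟩
  · rintro _ ⟨j, rfl⟩
    exact (W j).isClopen.isOpen
  · obtain ⟨j, hj⟩ := Set.mem_iUnion.1 (hcov (Set.mem_univ x))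
    exact ⟨_, ⟨j, rfl⟩, hj⟩
  · rintro _ ⟨j, rfl⟩
    obtain ⟨U, hU⟩ := (hW j).2
    exact ⟨U, U.2, hU⟩
  · rintro _ ⟨i, rfl⟩ _ ⟨j, rfl⟩ hij
    have hne : i ≠ j := fun h ↦ hij (h ▸ rfl)
    have := hdisj hne
    rw [Function.onFun, disjoint_iff] at this
    simp only [Function.onFun, id, Set.disjoint_iff_inter_eq_empty]
    simpa using congrArg (fun C : TopologicalSpace.Clopens X ↦ (C : Set X)) this

variable (X) in
theorem covDimLE_zero : CovDimLE X 0 := by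
  intro 𝒰 h𝒰
  obtain ⟨𝒱, hcov, href, hdisj⟩ := h𝒰.exists_pairwiseDisjoint_refinement
  refine ⟨𝒱, hcov, href, fun T hT ⟨x, hx⟩ ↦ ?_⟩
  rw [zero_add, Finset.card_le_one]
  exact fun s hs t ht ↦ hdisj.elim_set (hT hs) (hT ht) x (hx s hs) (hx t ht)

theorem rel_of_profinite {n : ℕ} (e₁ e₂ : Elem X n) : Rel X e₁ e₂ := by
  have hinter : IsCover X (Set.image2 (· ∩ ·) e₁.cov e₂.cov) := by
    refine ⟨?_, fun x ↦ ?_⟩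
    · rintro _ ⟨U, hU, V, hV, rfl⟩
      exact (e₁.isCover.1 U hU).inter (e₂.isCover.1 V hV)
    · obtain ⟨U, hU, hxU⟩ := e₁.isCover.2 x
      obtain ⟨V, hV, hxV⟩ := e₂.isCover.2 x
      exact ⟨_, ⟨U, hU, V, hV, rfl⟩, hxU, hxV⟩
  obtain ⟨𝒲, hcov, href, hdisj⟩ := hinter.exists_pairwiseDisjoint_refinement
  have h₁ : ∀ W, ∃ U, W ∈ 𝒲 → U ∈ e₁.cov ∧ W ⊆ U := fun W ↦ by
    by_cases hW : W ∈ 𝒲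
    · obtain ⟨_, ⟨U, hU, V, hV, rfl⟩, hWU⟩ := href W hW
      exact ⟨U, fun _ ↦ ⟨hU, hWU.trans Set.inter_subset_left⟩⟩
    · exact ⟨∅, fun h ↦ absurd h hW⟩
  have h₂ : ∀ W, ∃ V, W ∈ 𝒲 → V ∈ e₂.cov ∧ W ⊆ V := fun W ↦ by
    by_cases hW : W ∈ 𝒲
    · obtain ⟨_, ⟨U, hU, V, hV, rfl⟩, hWV⟩ := href W hW
      exact ⟨V, fun _ ↦ ⟨hV, hWV.trans Set.inter_subset_right⟩⟩
    · exact ⟨∅, fun h ↦ absurd h hW⟩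
  choose r₁ hr₁ using h₁
  choose r₂ hr₂ using h₂
  refine ⟨𝒲, r₁, r₂, fun τ ↦ e₁.coc (fun _ ↦ r₁ (τ 0)) - e₂.coc (fun _ ↦ r₂ (τ 0)),
    hcov, hr₁, hr₂, ?_⟩
  rintro σ ⟨hσ, x, hx⟩
  rw [Set.mem_iInter] at hx
  obtain ⟨W, rfl⟩ : ∃ W, σ = fun _ ↦ W :=
    ⟨σ 0, funext fun j ↦ hdisj.elim_set (hσ j) (hσ 0) x (hx j) (hx 0)⟩
  have hW := hσ 0
  have hxW := hx 0
  rw [coboundary_const]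
  by_cases hn : Even n
  · have z₁ := e₁.isCocycle.apply_const_eq_zero hn.add_one (hr₁ W hW).1 ⟨x, (hr₁ W hW).2 hxW⟩
    have z₂ := e₂.isCocycle.apply_const_eq_zero hn.add_one (hr₂ W hW).1 ⟨x, (hr₂ W hW).2 hxW⟩
    simp [hn, Function.comp_def, z₁, z₂]
  · simp [hn, Function.comp_def]

variable (X) in
theorem subsingleton_cechHSucc (n : ℕ) : Subsingleton (CechHSucc X n) :=
  ⟨fun x y ↦ Quot.induction_on₂ x y fun e₁ e₂ ↦ Quot.sound (rel_of_profinite e₁ e₂)⟩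

end Profinite

end CechPaper

theorem BoundedVariationOn.inv_of_le_norm {α : Type*} [LinearOrder α] {f : α → ℂ} {s : Set α}
    (hf : BoundedVariationOn f s) {δ : ℝ} (hδ : 0 < δ) (h : ∀ x ∈ s, δ ≤ ‖f x‖) :
    BoundedVariationOn (fun x ↦ (f x)⁻¹) s := by
  have hL : LipschitzOnWith (δ⁻¹ * δ⁻¹).toNNReal (fun z : ℂ ↦ z⁻¹) {z | δ ≤ ‖z‖} := by
    refine LipschitzOnWith.of_dist_le_mul fun z hz w hw ↦ ?_
    simp only [Set.mem_ofPred_eq] at hz hw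
    have hz0 : z ≠ 0 := norm_pos_iff.1 (hδ.trans_le hz)
    have hw0 : w ≠ 0 := norm_pos_iff.1 (hδ.trans_le hw)
    rw [dist_inv_inv₀ hz0 hw0, Real.coe_toNNReal _ (by positivity), div_eq_inv_mul, mul_inv]
    gcongr
  exact hL.comp_boundedVariationOn h hf

theorem Monotone.boundedVariationOn_univ {α : Type*} [LinearOrder α] [BoundedOrder α]
    {p : α → ℝ} (hp : Monotone p) : BoundedVariationOn p Set.univ := by
  simpa [Set.Icc_bot_top] using
    (hp.monotoneOn Set.univ).locallyBoundedVariationOn ⊥ ⊤ (Set.mem_univ _) (Set.mem_univ _)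

section BoundedVariation

variable {α : Type*} [LinearOrder α]
  {A : Type*} [NormedCommRing A] [NormedAlgebra ℂ A] {ι : A →ₐ[ℂ] (α → ℂ)}

theorem exists_norm_apply_sub_character_lt (hinj : Function.Injective ι)
    (hrange : ∀ f : α → ℂ, f ∈ Set.range ι ↔ BoundedVariationOn f Set.univ)
    (φ : characterSpace ℂ A) (g : A) {δ : ℝ} (hδ : 0 < δ) : ∃ x, ‖ι g x - φ g‖ < δ := by
  by_contra! hne
  set h : A := g - algebraMap ℂ A (φ g)
  have hh : ∀ x, ι h x = ι g x - φ g := fun x ↦ by simp [h]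
  obtain ⟨k, hk⟩ := (hrange _).2 <| ((hrange _).1 ⟨h, rfl⟩).inv_of_le_norm hδ
    fun x _ ↦ (hh x).symm ▸ hne x
  have hhk : h * k = 1 := hinj <| funext fun x ↦ by
    have : ι h x ≠ 0 := norm_pos_iff.1 (hδ.trans_le ((hh x).symm ▸ hne x))
    simp [hk, this]
  have hφ : φ h = 0 := by simp [h, AlgHomClass.commutes]
  simpa [hφ] using congrArg φ hhk

theorem character_im_eq_zero (hinj : Function.Injective ι)
    (hrange : ∀ f : α → ℂ, f ∈ Set.range ι ↔ BoundedVariationOn f Set.univ)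
    (φ : characterSpace ℂ A) {g : A} {p : α → ℝ} (hg : ∀ x, ι g x = p x) : (φ g).im = 0 := by
  by_contra h
  obtain ⟨x, hx⟩ := exists_norm_apply_sub_character_lt hinj hrange φ g (abs_pos.2 h)
  have := (Complex.abs_im_le_norm _).trans_lt hx
  simp [hg] at this

theorem exists_apply_eq_ofReal_of_monotone [BoundedOrder α]
    (hrange : ∀ f : α → ℂ, f ∈ Set.range ι ↔ BoundedVariationOn f Set.univ)
    {p : α → ℝ} (hp : Monotone p) : ∃ g, ∀ x, ι g x = p x := by
  obtain ⟨g, hg⟩ := (hrange fun x ↦ (p x : ℂ)).2 <|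
    Complex.isometry_ofReal.lipschitz.comp_boundedVariationOn hp.boundedVariationOn_univ
  exact ⟨g, congrFun hg⟩

theorem exists_isIdempotentElem_of_re_lt [BoundedOrder α] (hinj : Function.Injective ι)
    (hrange : ∀ f : α → ℂ, f ∈ Set.range ι ↔ BoundedVariationOn f Set.univ)
    {φ ψ : characterSpace ℂ A} {g : A} {p : α → ℝ} (hp : Monotone p) (hg : ∀ x, ι g x = p x)
    (hlt : (φ g).re < (ψ g).re) : ∃ e : A, IsIdempotentElem e ∧ φ e = 0 ∧ ψ e = 1 := by
  obtain ⟨t, hφt, htψ⟩ := exists_between hlt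
  obtain ⟨e, he⟩ := exists_apply_eq_ofReal_of_monotone (ι := ι) hrange
    (p := fun x ↦ if t ≤ p x then 1 else 0) <| by
      intro x y hxy
      have := hp hxy
      dsimp only
      split_ifs <;> linarith
  have hidem : IsIdempotentElem e := hinj <| funext fun x ↦ by
    by_cases hx : t ≤ p x <;> simp [he, hx]
  have h01 (χ : characterSpace ℂ A) : χ e = 0 ∨ χ e = 1 :=
    IsIdempotentElem.iff_eq_zero_or_one.1 (hidem.map χ)
  refine ⟨e, hidem, (h01 φ).resolve_right fun h ↦ ?_, (h01 ψ).resolve_left fun h ↦ ?_⟩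
  · obtain ⟨x, hx⟩ := exists_norm_apply_sub_character_lt hinj hrange φ
      (g * e + algebraMap ℂ A t * (1 - e)) (sub_pos.2 hφt)
    have := (le_abs_self _).trans_lt ((Complex.abs_re_le_norm _).trans_lt hx)
    by_cases hx : t ≤ p x
    · simp [he, hg, h, hx, AlgHomClass.commutes] at this
      linarith
    · simp [he, hg, h, hx, AlgHomClass.commutes] at this
  · obtain ⟨x, hx⟩ := exists_norm_apply_sub_character_lt hinj hrange ψ
      (g * (1 - e) + algebraMap ℂ A t * e) (sub_pos.2 htψ)
    have := (neg_le_abs _).trans_lt ((Complex.abs_re_le_norm _).trans_lt hx)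
    by_cases hx : t ≤ p x
    · simp [he, hg, h, hx, AlgHomClass.commutes] at this
    · simp [he, hg, h, hx, AlgHomClass.commutes] at this
      linarith

theorem exists_monotone_character_ne [BoundedOrder α] (hinj : Function.Injective ι)
    (hrange : ∀ f : α → ℂ, f ∈ Set.range ι ↔ BoundedVariationOn f Set.univ)
    {φ ψ : characterSpace ℂ A} (hne : φ ≠ ψ) :
    ∃ (g : A) (p : α → ℝ), Monotone p ∧ (∀ x, ι g x = p x) ∧ φ g ≠ ψ g := by
  by_contra! hmono
  refine hne (CharacterSpace.ext fun g ↦ ?_)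
  have hreal (f : α → ℝ) (hf : BoundedVariationOn f Set.univ) :
      ∃ k : A, (∀ x, ι k x = f x) ∧ φ k = ψ k := by
    obtain ⟨p, q, hp, hq, rfl⟩ := hf.locallyBoundedVariationOn.exists_monotoneOn_sub_monotoneOn
    rw [monotoneOn_univ] at hp hq
    obtain ⟨gp, hgp⟩ := exists_apply_eq_ofReal_of_monotone hrange hp
    obtain ⟨gq, hgq⟩ := exists_apply_eq_ofReal_of_monotone hrange hq
    exact ⟨gp - gq, fun x ↦ by simp [hgp, hgq],
      by rw [map_sub, map_sub, hmono gp p hp hgp, hmono gq q hq hgq]⟩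
  have hg := (hrange _).1 ⟨g, rfl⟩
  obtain ⟨u, hu, hu'⟩ := hreal _ <|
    Complex.reCLM.lipschitz.comp_boundedVariationOn hg
  obtain ⟨v, hv, hv'⟩ := hreal _ <|
    Complex.imCLM.lipschitz.comp_boundedVariationOn hg
  have huv : g = u + algebraMap ℂ A Complex.I * v := hinj <| funext fun x ↦ by
    simp [hu, hv, mul_comm Complex.I]
  simp [huv, hu', hv', AlgHomClass.commutes]

theorem exists_isIdempotentElem_separating [BoundedOrder α] (hinj : Function.Injective ι)
    (hrange : ∀ f : α → ℂ, f ∈ Set.range ι ↔ BoundedVariationOn f Set.univ)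
    {φ ψ : characterSpace ℂ A} (hne : φ ≠ ψ) :
    ∃ e : A, IsIdempotentElem e ∧ φ e = 0 ∧ ψ e = 1 := by
  obtain ⟨g, p, hp, hg, hφψ⟩ := exists_monotone_character_ne hinj hrange hne
  have hre : (φ g).re ≠ (ψ g).re := fun h ↦ hφψ <| Complex.ext h <| by
    rw [character_im_eq_zero hinj hrange φ hg, character_im_eq_zero hinj hrange ψ hg]
  rcases hre.lt_or_gt with h | h
  · exact exists_isIdempotentElem_of_re_lt hinj hrange hp hg h
  · obtain ⟨e, he, hψ, hφ⟩ := exists_isIdempotentElem_of_re_lt hinj hrange hp hg h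
    exact ⟨1 - e, he.one_sub, by simp [hφ], by simp [hψ]⟩

end BoundedVariation

theorem isClopen_character_apply_eq_zero {A : Type*} [NormedCommRing A] [NormedAlgebra ℂ A]
    {e : A} (he : IsIdempotentElem e) : IsClopen {χ : characterSpace ℂ A | χ e = 0} := by
  have hcont : Continuous fun χ : characterSpace ℂ A ↦ χ e :=
    (WeakDual.eval_continuous e).comp continuous_subtype_val
  refine ⟨isClosed_singleton.preimage hcont, ?_⟩
  convert (isClosed_singleton.preimage hcont : IsClosed {χ : characterSpace ℂ A | χ e = 1}).isOpen_compl using 1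
  ext χ
  rcases IsIdempotentElem.iff_eq_zero_or_one.1 (he.map χ) with h | h <;> simp [h]

theorem totallySeparatedSpace_characterSpace {A : Type*} [NormedCommRing A] [NormedAlgebra ℂ A]
    (h : ∀ φ ψ : characterSpace ℂ A, φ ≠ ψ → ∃ e : A, IsIdempotentElem e ∧ φ e = 0 ∧ ψ e = 1) :
    TotallySeparatedSpace (characterSpace ℂ A) := by
  refine totallySeparatedSpace_iff_exists_isClopen.2 fun φ ψ hne ↦ ?_
  obtain ⟨e, he, hφ, hψ⟩ := h φ ψ hne
  exact ⟨_, isClopen_character_apply_eq_zero he, hφ, by simp [hψ]⟩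

/-! **Statement 15.**
Let `I = [a,b]` be a finite interval and let `BV(I)` be the Banach algebra of
complex-valued functions of bounded variation on `I`, with the norm
`‖f‖ = sup_I |f| + V_I(f)` (encoded below by an abstract complex Banach algebra `A`
together with an algebra isomorphism `ι` onto the algebra of functions of bounded
variation on `I`, under which the norm of `A` is `sup + variation`).  Then the maximal
ideal space `𝔐(BV(I))` (the character space) has covering dimension `0`, and all its
Čech cohomology groups `Hⁱ(𝔐(BV(I)), ℤ)`, `i ≥ 1`, vanish (a group vanishes iff it is
a subsingleton; below `CechHSucc _ i` is `H^{i+1}`, so that as `i` ranges over `ℕ` all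
degrees `≥ 1` occur). -/

theorem characterSpace_of_BV_is_zero_dimensional_with_vanishing_cohomology
    {a b : ℝ} (hab : a < b)
    (A : Type) [NormedCommRing A] [NormedAlgebra ℂ A] [CompleteSpace A]
    (ι : A →ₐ[ℂ] (Set.Icc a b → ℂ))
    (hinj : Function.Injective ι)
    (hrange : ∀ f : Set.Icc a b → ℂ,
      (f ∈ Set.range ι) ↔ BoundedVariationOn f Set.univ)
    (hnorm : ∀ g : A, ‖g‖ =
      sSup (Set.range fun x => ‖ι g x‖) + (eVariationOn (ι g) Set.univ).toReal) :
    (CovDimLE (characterSpace ℂ A) 0 ∧ Nonempty (characterSpace ℂ A)) ∧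
      ∀ i : ℕ, Subsingleton (CechHSucc (characterSpace ℂ A) i) := by
  have : Fact (a ≤ b) := ⟨hab.le⟩
  have : TotallySeparatedSpace (characterSpace ℂ A) :=
    totallySeparatedSpace_characterSpace fun _ _ hne ↦
      exists_isIdempotentElem_separating hinj hrange hne
  have : Nontrivial A := ι.toRingHom.domain_nontrivial
  exact ⟨⟨covDimLE_zero _, inferInstance⟩, subsingleton_cechHSucc _⟩
end

section
/- Let I=[a,b] be a finite interval and let Lip(I) be the Banach algebra of complex-valued Lipschitz functions on I with norm ‖f‖ := max_I |f| + sup_{x≠y} |f(x)−f(y)|/|x−y|. Then every nonzero continuous algebra homomorphism φ : Lip(I) → ℂ is evaluation at some point x ∈ I, and the resulting map I → 𝔐(Lip(I)) is a homeomorphism; in particular 𝔐(Lip(I)) is homeomorphic to I. -/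
open WeakDual

theorem LipschitzWith.exists_inv₀ {X 𝕜 : Type*} [PseudoMetricSpace X] [CompactSpace X]
    [NormedField 𝕜] {K : NNReal} {f : X → 𝕜} (hf : LipschitzWith K f) (h0 : ∀ x, f x ≠ 0) :
    ∃ C : NNReal, LipschitzWith C fun x => (f x)⁻¹ := by
  obtain ⟨m, hm, hle⟩ : ∃ m : ℝ, 0 < m ∧ ∀ x, m ≤ ‖f x‖ := by
    rcases isEmpty_or_nonempty X with hX | hX
    · exact ⟨1, one_pos, fun x => hX.elim x⟩
    · obtain ⟨x₀, -, hx₀⟩ := isCompact_univ.exists_isMinOn Set.univ_nonempty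
        hf.continuous.norm.continuousOn
      exact ⟨‖f x₀‖, norm_pos_iff.2 (h0 x₀), fun x => hx₀ (Set.mem_univ x)⟩
  refine ⟨⟨K / (m * m), by positivity⟩, LipschitzWith.of_dist_le_mul fun x y => ?_⟩
  change _ ≤ (K : ℝ) / (m * m) * dist x y
  rw [dist_inv_inv₀ (h0 x) (h0 y), div_mul_eq_mul_div]
  have hx := hle x
  have hy := hle y
  gcongr
  exact hf.dist_le_mul x y

/-- If the range of an injective algebra homomorphism into the functions on a compact space
consists of the Lipschitz functions, every element killed by a complex character vanishes at
some point. -/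
theorem exists_apply_eq_zero_of_lipschitz_range {X A : Type*} [PseudoMetricSpace X]
    [CompactSpace X] [CommRing A] [Algebra ℂ A] (ι : A →ₐ[ℂ] (X → ℂ))
    (hinj : Function.Injective ι)
    (hrange : ∀ f : X → ℂ, f ∈ Set.range ι ↔ ∃ C : NNReal, LipschitzWith C f)
    (φ : A →ₐ[ℂ] ℂ) {u : A} (hu : φ u = 0) : ∃ x, ι u x = 0 := by
  by_contra! h0
  obtain ⟨K, hK⟩ := (hrange (ι u)).1 ⟨u, rfl⟩
  obtain ⟨v, hv⟩ := (hrange _).2 (hK.exists_inv₀ h0)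
  have huv : u * v = 1 := by
    apply hinj
    ext x
    simp [hv, h0 x]
  have := congrArg φ huv
  simp [hu] at this

/-- Two elements of the algebra of Lipschitz functions attain their values under a character
at a common point. -/
theorem exists_common_apply_eq_of_lipschitz_range {X A : Type*} [PseudoMetricSpace X]
    [CompactSpace X] [CommRing A] [Algebra ℂ A] (ι : A →ₐ[ℂ] (X → ℂ))
    (hinj : Function.Injective ι)
    (hrange : ∀ f : X → ℂ, f ∈ Set.range ι ↔ ∃ C : NNReal, LipschitzWith C f)
    (φ : A →ₐ[ℂ] ℂ) (f g : A) : ∃ x, ι f x = φ f ∧ ι g x = φ g := by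
  have hconj : ∀ u : A, ∃ v : A, ∀ x, ι v x = starRingEnd ℂ (ι u x) := fun u => by
    obtain ⟨K, hK⟩ := (hrange (ι u)).1 ⟨u, rfl⟩
    obtain ⟨v, hv⟩ := (hrange fun x => starRingEnd ℂ (ι u x)).2
      ⟨_, Complex.isometry_conj.lipschitz.comp hK⟩
    exact ⟨v, congrFun hv⟩
  obtain ⟨f', hf'⟩ := hconj (f - algebraMap ℂ A (φ f))
  obtain ⟨g', hg'⟩ := hconj (g - algebraMap ℂ A (φ g))
  obtain ⟨x, hx⟩ := exists_apply_eq_zero_of_lipschitz_range ι hinj hrange φ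
    (u := (f - algebraMap ℂ A (φ f)) * f' + (g - algebraMap ℂ A (φ g)) * g') (by simp)
  refine ⟨x, ?_⟩
  rw [map_add, map_mul, map_mul, Pi.add_apply, Pi.mul_apply, Pi.mul_apply, hf', hg',
    Complex.mul_conj, Complex.mul_conj, ← Complex.ofReal_add, Complex.ofReal_eq_zero,
    add_eq_zero_iff_of_nonneg (Complex.normSq_nonneg _) (Complex.normSq_nonneg _),
    Complex.normSq_eq_zero, Complex.normSq_eq_zero] at hx
  simpa [sub_eq_zero] using hx

/-! **Statement 18.**
Let `I = [a,b]` be a finite interval and `Lip(I)` the Banach algebra of complex-valued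
Lipschitz functions on `I` with norm `‖f‖ = max_I |f| + sup_{x≠y} |f x − f y|/|x − y|`
(encoded below by an abstract complex Banach algebra `A` with an algebra isomorphism
`ι` onto the algebra of Lipschitz functions on `I`, under which the norm is as above).
Then every character of `Lip(I)` is an evaluation at a point of `I`, and the
evaluation map `I → 𝔐(Lip(I))` is a homeomorphism. -/

theorem characterSpace_of_Lipschitz_algebra_is_I
    {a b : ℝ} (hab : a < b)
    (A : Type) [NormedCommRing A] [NormedAlgebra ℂ A] [CompleteSpace A]
    (ι : A →ₐ[ℂ] (Set.Icc a b → ℂ))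
    (hinj : Function.Injective ι)
    (hrange : ∀ f : Set.Icc a b → ℂ,
      (f ∈ Set.range ι) ↔ ∃ C : NNReal, LipschitzWith C f)
    (hnorm : ∀ g : A, ‖g‖ = sSup (Set.range fun x => ‖ι g x‖) +
      sSup {r : ℝ | ∃ x y : Set.Icc a b, x ≠ y ∧
        r = ‖ι g x - ι g y‖ / |(x : ℝ) - (y : ℝ)|}) :
    (∀ φ : characterSpace ℂ A, ∃ x : Set.Icc a b, ∀ g : A, φ g = ι g x) ∧
    ∃ h : Set.Icc a b ≃ₜ characterSpace ℂ A,
      ∀ (x : Set.Icc a b) (g : A), (h x) g = ι g x := by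
  obtain ⟨z, hz⟩ := (hrange fun x => ((x : ℝ) : ℂ)).2
    ⟨_, Complex.isometry_ofReal.lipschitz.comp isometry_subtype_coe.lipschitz⟩
  have heval : ∀ φ : characterSpace ℂ A, ∃ x : Set.Icc a b, ∀ g : A, φ g = ι g x := fun φ => by
    have hcommon := exists_common_apply_eq_of_lipschitz_range ι hinj hrange
      (CharacterSpace.toAlgHom φ) z
    obtain ⟨x, hx, -⟩ := hcommon z
    refine ⟨x, fun g => ?_⟩
    obtain ⟨y, hy, hyg⟩ := hcommon g
    have hyx : y = x := by
      have h := hy.trans hx.symm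
      rw [hz] at h
      exact Subtype.ext (Complex.ofReal_injective h)
    rw [← hyx, hyg]
    rfl
  refine ⟨heval, ?_⟩
  let e : Set.Icc a b → characterSpace ℂ A := fun x =>
    CharacterSpace.equivAlgHom.symm ((Pi.evalAlgHom ℂ (fun _ => ℂ) x).comp ι)
  have he : ∀ x g, e x g = ι g x := fun _ _ => rfl
  have hbij : Function.Bijective e := by
    refine ⟨fun x y hxy => ?_, fun φ => ?_⟩
    · have h : ι z x = ι z y := by rw [← he, ← he, hxy]
      rw [hz] at h
      exact Subtype.ext (Complex.ofReal_injective h)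
    · obtain ⟨x, hx⟩ := heval φ
      exact ⟨x, CharacterSpace.ext fun g => (hx g).symm⟩
  have hcont : Continuous e := by
    refine Continuous.subtype_mk (WeakDual.continuous_of_continuous_eval fun g => ?_) _
    obtain ⟨K, hK⟩ := (hrange (ι g)).1 ⟨g, rfl⟩
    exact hK.continuous
  exact ⟨Continuous.homeoOfEquivCompactToT2 (f := Equiv.ofBijective e hbij) hcont, he⟩
end
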